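/- For every ground program P over a type α of atoms and every i ≥ 1, the true set of the alternating fixpoint procedure satisfies the optimized recurrence K_i = K_{i-1} ∪ lfp(S ↦ T_{P,U_{i-1}}(K_{i-1} ∪ S)); that is, K_i is obtained from K_{i-1} by adjoining the least fixed point of the operator that applies T_{P,U_{i-1}} to the union of K_{i-1} with its argument. -/

import Mathlib

/-- A ground rule: head atom, finite set of positive subgoals, finite set of negative subgoals. -/
structure GroundRule (α : Type*) where
  head : α
  pos : Finset α
  neg : Finset α

/-- The extended immediate consequence operator `T_{P,J}(I)`. -/
def Tstep {α : Type*} (P : Set (GroundRule α)) (J I : Set α) : Set α :=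
  {a | ∃ r ∈ P, r.head = a ∧ ↑r.pos ⊆ I ∧ (↑r.neg ∩ J : Set α) = ∅}

lemma Tstep_mono {α : Type*} (P : Set (GroundRule α)) (J : Set α) : Monotone (Tstep P J) := by
  rintro I I' h a ⟨r, hr, hh, hpos, hneg⟩
  exact ⟨r, hr, hh, hpos.trans h, hneg⟩

/-- `T_{P,J}` bundled as a monotone map on the complete lattice of subsets of `α`. -/
def TstepHom {α : Type*} (P : Set (GroundRule α)) (J : Set α) : Set α →o Set α :=
  ⟨Tstep P J, Tstep_mono P J⟩

/-- The least fixed point of `I ↦ T_{P,J}(I)` (Knaster–Tarski). -/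
def Tlfp {α : Type*} (P : Set (GroundRule α)) (J : Set α) : Set α :=
  OrderHom.lfp (TstepHom P J)

/-- The definite part `P⁺` of `P`: the rules with no negative subgoals. -/
def definitePart {α : Type*} (P : Set (GroundRule α)) : Set (GroundRule α) :=
  {r ∈ P | r.neg = ∅}

/-- The alternating fixpoint sequence `(K_i, U_i)`:
`K₀ := lfp (T_{P⁺,∅})`, `U₀ := lfp (T_{P,K₀})`, and for `i > 0`,
`K_i := lfp (T_{P,U_{i-1}})`, `U_i := lfp (T_{P,K_i})`. -/
def AFP {α : Type*} (P : Set (GroundRule α)) : ℕ → Set α × Set α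
  | 0 => (Tlfp (definitePart P) ∅, Tlfp P (Tlfp (definitePart P) ∅))
  | i + 1 => (Tlfp P (AFP P i).2, Tlfp P (Tlfp P (AFP P i).2))

/-- The true (known) sets `K_i` of the alternating fixpoint procedure. -/
def Kseq {α : Type*} (P : Set (GroundRule α)) (i : ℕ) : Set α := (AFP P i).1

/-- The possible (unknown) sets `U_i` of the alternating fixpoint procedure. -/
def Useq {α : Type*} (P : Set (GroundRule α)) (i : ℕ) : Set α := (AFP P i).2

lemma Tstep_antitone {α : Type*} (P : Set (GroundRule α)) {J J' : Set α} (h : J ⊆ J')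
    (I : Set α) : Tstep P J' I ⊆ Tstep P J I := by
  rintro a ⟨r, hr, hh, hpos, hneg⟩
  exact ⟨r, hr, hh, hpos,
    Set.subset_eq_empty (Set.inter_subset_inter_right _ h) hneg⟩

lemma Tstep_Tlfp {α : Type*} (P : Set (GroundRule α)) (J : Set α) :
    Tstep P J (Tlfp P J) = Tlfp P J :=
  (TstepHom P J).map_lfp

lemma Tlfp_subset {α : Type*} {P : Set (GroundRule α)} {J I : Set α} (h : Tstep P J I ⊆ I) :
    Tlfp P J ⊆ I :=
  (TstepHom P J).lfp_le h

lemma Tlfp_antitone {α : Type*} (P : Set (GroundRule α)) : Antitone (Tlfp P) := fun J _ h =>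
  Tlfp_subset ((Tstep_antitone P h _).trans (Tstep_Tlfp P J).subset)

lemma Tlfp_definitePart_subset {α : Type*} (P : Set (GroundRule α)) (J J' : Set α) :
    Tlfp (definitePart P) J' ⊆ Tlfp P J := by
  refine Tlfp_subset (Set.Subset.trans ?_ (Tstep_Tlfp P J).subset)
  rintro a ⟨r, ⟨hr, hneg⟩, hh, hpos, -⟩
  exact ⟨r, hr, hh, hpos, by simp [hneg]⟩

lemma Kseq_succ {α : Type*} (P : Set (GroundRule α)) (i : ℕ) :
    Kseq P (i + 1) = Tlfp P (Useq P i) := rfl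

lemma Useq_eq {α : Type*} (P : Set (GroundRule α)) (i : ℕ) :
    Useq P i = Tlfp P (Kseq P i) := by
  cases i <;> rfl

lemma Kseq_subset_succ {α : Type*} (P : Set (GroundRule α)) (i : ℕ) :
    Kseq P i ⊆ Kseq P (i + 1) := by
  induction i with
  | zero => exact Tlfp_definitePart_subset P _ _
  | succ i ih =>
    rw [Kseq_succ, Kseq_succ P (i + 1), Useq_eq, Useq_eq]
    exact Tlfp_antitone P (Tlfp_antitone P ih)

/-- Optimized recurrence for the true sets: for `i ≥ 1`,
`K_i = K_{i-1} ∪ lfp (S ↦ T_{P,U_{i-1}}(K_{i-1} ∪ S))`. -/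
theorem Kseq_opt_recurrence {α : Type*} (P : Set (GroundRule α)) (i : ℕ) (hi : 1 ≤ i) :
    Kseq P i = Kseq P (i - 1) ∪
      OrderHom.lfp ⟨fun S => Tstep P (Useq P (i - 1)) (Kseq P (i - 1) ∪ S),
        fun _ _ h => Tstep_mono P _ (Set.union_subset_union_right _ h)⟩ := by
  obtain ⟨i, rfl⟩ := Nat.exists_eq_add_of_le' hi
  rw [Nat.add_sub_cancel]
  apply Set.Subset.antisymm
  · refine Tlfp_subset (Set.Subset.trans ?_ Set.subset_union_right)
    exact (OrderHom.map_lfp (α := Set α)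
      ⟨fun S => Tstep P (Useq P i) (Kseq P i ∪ S),
        fun _ _ h => Tstep_mono P _ (Set.union_subset_union_right _ h)⟩).le
  · refine Set.union_subset (Kseq_subset_succ P i) (OrderHom.lfp_le _ ?_)
    change Tstep P (Useq P i) (Kseq P i ∪ Kseq P (i + 1)) ⊆ Kseq P (i + 1)
    rw [Set.union_eq_self_of_subset_left (Kseq_subset_succ P i)]
    exact (Tstep_Tlfp P (Useq P i)).subset
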